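/- (Existence and uniqueness of reduced Gröbner bases) Let K be a field, σ a finite type of indeterminates, and fix an admissible monomial order ≼ on σ →₀ ℕ. Then for every finite set F ⊆ MvPolynomial σ K there exists a unique reduced Gröbner basis G with Ideal.span G = Ideal.span F. -/

import Mathlib

open MvPolynomial Relation

/-- An admissible monomial order on `σ →₀ ℕ`: a linear order such that `0` is the
smallest element and which is compatible with addition. -/
structure AdmissibleOrder (σ : Type*) where
  le : (σ →₀ ℕ) → (σ →₀ ℕ) → Prop
  total : ∀ s t, le s t ∨ le t s
  refl : ∀ t, le t t
  trans : ∀ s t u, le s t → le t u → le s u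
  antisymm : ∀ s t, le s t → le t s → s = t
  zero_le : ∀ t, le 0 t
  add_right : ∀ s t u, le s t → le (s + u) (t + u)

namespace AdmissibleOrder

variable {σ : Type*} {K : Type*} [Field K]

/-- The strict part of an admissible order. -/
def lt (m : AdmissibleOrder σ) (s t : σ →₀ ℕ) : Prop := m.le s t ∧ s ≠ t

-- The leading monomial of a polynomial: the `m.le`-largest element of its support
-- (`0` for the zero polynomial).
open Classical in
noncomputable def lm (m : AdmissibleOrder σ) (p : MvPolynomial σ K) : σ →₀ ℕ :=
  if h : ∃ v, v ∈ p.support ∧ ∀ u ∈ p.support, m.le u v then h.choose else 0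

/-- The leading coefficient of a polynomial. -/
noncomputable def lc (m : AdmissibleOrder σ) (p : MvPolynomial σ K) : K :=
  coeff (m.lm p) p

/-- One-step polynomial reduction modulo a set `F`. -/
def Red (m : AdmissibleOrder σ) (F : Set (MvPolynomial σ K))
    (p q : MvPolynomial σ K) : Prop :=
  ∃ f ∈ F, f ≠ 0 ∧ ∃ t : σ →₀ ℕ,
    coeff (t + m.lm f) p ≠ 0 ∧
    q = p - (coeff (t + m.lm f) p / m.lc f) • (monomial t (1 : K)) * f

/-- A set `G` is a Gröbner basis iff the reduction relation modulo `G` is confluent. -/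
def IsGroebner (m : AdmissibleOrder σ) (G : Set (MvPolynomial σ K)) : Prop :=
  ∀ a b c : MvPolynomial σ K, ReflTransGen (m.Red G) a b → ReflTransGen (m.Red G) a c →
    ∃ d, ReflTransGen (m.Red G) b d ∧ ReflTransGen (m.Red G) c d

-- The S-polynomial of two polynomials.
open Classical in
noncomputable def spoly (m : AdmissibleOrder σ) (p q : MvPolynomial σ K) :
    MvPolynomial σ K :=
  if p = 0 ∨ q = 0 then 0 else
    (monomial (m.lm p ⊔ m.lm q - m.lm p) (1 / m.lc p)) * p -
    (monomial (m.lm p ⊔ m.lm q - m.lm q) (1 / m.lc q)) * q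

end AdmissibleOrder

/-- A finite set `B` is a reduced Gröbner basis iff it is a Gröbner basis, it is
auto-reduced (no `b ∈ B` is reducible modulo `B \ {b}`), `0 ∉ B`, and every element
of `B` is monic. -/
def AdmissibleOrder.IsReducedGroebner {σ K : Type*} [Field K] (m : AdmissibleOrder σ)
    (B : Set (MvPolynomial σ K)) : Prop :=
  B.Finite ∧ m.IsGroebner B ∧ (∀ b ∈ B, ¬ ∃ q, m.Red (B \ {b}) b q) ∧
    (0 : MvPolynomial σ K) ∉ B ∧ ∀ b ∈ B, m.lc b = 1

namespace AdmissibleOrder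

variable {σ K : Type*} [Field K] (m : AdmissibleOrder σ)

theorem le_of_le {s t : σ →₀ ℕ} (h : s ≤ t) : m.le s t := by
  have := m.add_right 0 (t - s) s (m.zero_le _)
  rwa [zero_add, tsub_add_cancel_of_le h] at this

theorem lt_of_le_of_lt {s t u : σ →₀ ℕ} (h : m.le s t) (h' : m.lt t u) : m.lt s u :=
  ⟨m.trans _ _ _ h h'.1, fun e => h'.2 (m.antisymm _ _ h'.1 (e ▸ h))⟩

theorem lt_trans {s t u : σ →₀ ℕ} (h : m.lt s t) (h' : m.lt t u) : m.lt s u :=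
  m.lt_of_le_of_lt h.1 h'

theorem wellFounded_lt [Finite σ] : WellFounded m.lt := by
  refine wellFounded_iff_isEmpty_descending_chain.2 ⟨fun ⟨f, hf⟩ => ?_⟩
  obtain ⟨i, j, hij, hle⟩ := wellQuasiOrdered_le f
  have key : ∀ k, m.lt (f (i + k + 1)) (f i) := by
    intro k
    induction k with
    | zero => exact hf i
    | succ k ih => exact m.lt_trans (hf (i + k + 1)) ih
  obtain ⟨k, rfl⟩ := Nat.exists_eq_add_of_lt hij
  exact (key k).2 (m.antisymm _ _ (key k).1 (m.le_of_le hle))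

theorem exists_max_support {p : MvPolynomial σ K} (hp : p ≠ 0) :
    ∃ v, v ∈ p.support ∧ ∀ u ∈ p.support, m.le u v := by
  have key : ∀ s : Finset (σ →₀ ℕ), s.Nonempty → ∃ v, v ∈ s ∧ ∀ u ∈ s, m.le u v := by
    intro s hs
    induction hs using Finset.Nonempty.cons_induction with
    | singleton a => exact ⟨a, by simp, by simpa using m.refl a⟩
    | cons a s ha hs ih =>
      obtain ⟨v, hv, hmax⟩ := ih
      rcases m.total a v with h | h
      · refine ⟨v, by simp [hv], fun u hu => ?_⟩
        rcases Finset.mem_cons.1 hu with rfl | hu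
        exacts [h, hmax u hu]
      · refine ⟨a, by simp, fun u hu => ?_⟩
        rcases Finset.mem_cons.1 hu with rfl | hu
        exacts [m.refl _, m.trans _ _ _ (hmax u hu) h]
  exact key _ (support_nonempty.2 hp)

theorem lm_mem_support {p : MvPolynomial σ K} (hp : p ≠ 0) : m.lm p ∈ p.support := by
  have h := m.exists_max_support hp
  rw [lm, dif_pos h]
  exact h.choose_spec.1

theorem lc_ne_zero {p : MvPolynomial σ K} (hp : p ≠ 0) : m.lc p ≠ 0 :=
  mem_support_iff.1 (m.lm_mem_support hp)

theorem le_lm {p : MvPolynomial σ K} {u : σ →₀ ℕ} (hu : u ∈ p.support) : m.le u (m.lm p) := by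
  have h := m.exists_max_support (support_nonempty.1 ⟨u, hu⟩)
  rw [lm, dif_pos h]
  exact h.choose_spec.2 u hu

theorem lm_eq {p : MvPolynomial σ K} {v : σ →₀ ℕ} (hv : v ∈ p.support)
    (h : ∀ u ∈ p.support, m.le u v) : m.lm p = v :=
  m.antisymm _ _ (h _ (m.lm_mem_support (support_nonempty.1 ⟨v, hv⟩))) (m.le_lm hv)

/-- Support of a shifted polynomial lies below the shifted leading monomial. -/
theorem le_of_mem_support_monomial_mul {g : MvPolynomial σ K} {t v : σ →₀ ℕ} {c : K}
    (hv : coeff v (c • monomial t (1 : K) * g) ≠ 0) : m.le v (t + m.lm g) := by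
  classical
  rw [smul_mul_assoc, coeff_smul, coeff_monomial_mul'] at hv
  split_ifs at hv with h
  · have := m.add_right _ _ t (m.le_lm (p := g) (u := v - t) (mem_support_iff.2 (by aesop)))
    rwa [tsub_add_cancel_of_le h, add_comm] at this
  · simp at hv

theorem coeff_lead_monomial_mul (g : MvPolynomial σ K) (t : σ →₀ ℕ) (c : K) :
    coeff (t + m.lm g) (c • monomial t (1 : K) * g) = c * m.lc g := by
  rw [smul_mul_assoc, coeff_smul, coeff_monomial_mul, one_mul, smul_eq_mul, lc]

/-- Cancelling the largest term leaves only strictly smaller terms. -/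
theorem lt_of_mem_support_sub {p g : MvPolynomial σ K} (hg : g ≠ 0) {t v : σ →₀ ℕ}
    (hp : ∀ w ∈ p.support, m.le w (t + m.lm g))
    (hv : v ∈ (p - (coeff (t + m.lm g) p / m.lc g) • monomial t (1 : K) * g).support) :
    m.lt v (t + m.lm g) := by
  rw [mem_support_iff, coeff_sub] at hv
  constructor
  · by_cases h : coeff v p = 0
    · exact m.le_of_mem_support_monomial_mul (fun h' => hv (by rw [h, h', sub_zero]))
    · exact hp v (mem_support_iff.2 h)
  · rintro rfl
    rw [coeff_lead_monomial_mul, div_mul_cancel₀ _ (m.lc_ne_zero hg), sub_self] at hv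
    exact hv rfl

theorem sub_mem_span_of_red {G : Set (MvPolynomial σ K)} {p q : MvPolynomial σ K}
    (h : m.Red G p q) : p - q ∈ Ideal.span G := by
  obtain ⟨f, hf, -, t, -, rfl⟩ := h
  rw [sub_sub_cancel]
  exact Ideal.mul_mem_left _ _ (Ideal.subset_span hf)

theorem sub_mem_span_of_reflTransGen {G : Set (MvPolynomial σ K)} {p q : MvPolynomial σ K}
    (h : ReflTransGen (m.Red G) p q) : p - q ∈ Ideal.span G := by
  induction h with
  | refl => simp
  | tail _ h ih => simpa using add_mem ih (m.sub_mem_span_of_red h)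

theorem reflTransGen_sub {G : Set (MvPolynomial σ K)} {g : MvPolynomial σ K} (hg : g ∈ G)
    (hg0 : g ≠ 0) (p : MvPolynomial σ K) (t : σ →₀ ℕ) :
    ReflTransGen (m.Red G) p
      (p - (coeff (t + m.lm g) p / m.lc g) • monomial t (1 : K) * g) := by
  by_cases h : coeff (t + m.lm g) p = 0
  · simp only [h, zero_div, zero_smul, zero_mul, sub_zero]
    exact .refl
  · exact .single ⟨g, hg, hg0, t, h, rfl⟩

/-- Polynomials differing by a term multiple of an element of `G` have a common reduct. -/
theorem join_add_monomial_mul {G : Set (MvPolynomial σ K)} {g : MvPolynomial σ K} (hg : g ∈ G)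
    (q : MvPolynomial σ K) (t : σ →₀ ℕ) (c : K) :
    Join (ReflTransGen (m.Red G)) (q + monomial t c * g) q := by
  by_cases hg0 : g = 0
  · subst hg0
    simpa using ⟨q, .refl, .refl⟩
  have hc : monomial t c = c • monomial t (1 : K) := by simp [smul_monomial]
  refine ⟨_, m.reflTransGen_sub hg hg0 _ t, ?_⟩
  convert m.reflTransGen_sub hg hg0 q t using 1
  rw [hc, coeff_add, coeff_lead_monomial_mul, add_div, mul_div_cancel_right₀ _ (m.lc_ne_zero hg0),
    add_smul]
  ring

theorem IsGroebner.join_add {m : AdmissibleOrder σ} {G : Set (MvPolynomial σ K)}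
    (hG : m.IsGroebner G) {x : MvPolynomial σ K} (hx : x ∈ Ideal.span G) (q : MvPolynomial σ K) :
    Join (ReflTransGen (m.Red G)) (q + x) q := by
  have equiv : Equivalence (Join (ReflTransGen (m.Red G))) :=
    equivalence_join (fun a b c => hG a b c)
  suffices h : ∀ a q : MvPolynomial σ K, Join (ReflTransGen (m.Red G)) (q + a * x) q by
    simpa using h 1 q
  induction hx using Submodule.span_induction with
  | mem g hg =>
    intro a
    induction a using MvPolynomial.induction_on' with
    | monomial t c => exact fun q => m.join_add_monomial_mul hg q t c
    | add a b ha hb =>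
      intro q
      have := equiv.trans (hb (q + a * g)) (ha q)
      rwa [add_assoc, ← add_mul] at this
  | zero => intro a q; simpa using equiv.refl q
  | add x y _ _ hx hy =>
    intro a q
    have := equiv.trans (hy a (q + a * x)) (hx a q)
    rwa [add_assoc, ← mul_add] at this
  | smul b x _ hx =>
    intro a q
    simpa [mul_assoc] using hx (a * b) q

/-- The leading monomial of an element of the ideal is divisible by one of a Gröbner basis. -/
theorem IsGroebner.exists_lm_le {m : AdmissibleOrder σ} {G : Set (MvPolynomial σ K)}
    (hG : m.IsGroebner G) {p : MvPolynomial σ K} (hp : p ∈ Ideal.span G) (hp0 : p ≠ 0) :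
    ∃ g ∈ G, g ≠ 0 ∧ m.lm g ≤ m.lm p := by
  obtain ⟨d, hpd, h0d⟩ := hG.join_add hp 0
  rw [zero_add] at hpd
  have hd : d = 0 := by
    rcases ReflTransGen.cases_head h0d with h | ⟨_, ⟨_, _, _, _, h, _⟩, _⟩
    · exact h.symm
    · simp at h
  subst hd
  by_contra! hno
  suffices h : ∀ q, ReflTransGen (m.Red G) p q →
      coeff (m.lm p) q ≠ 0 ∧ ∀ v ∈ q.support, m.le v (m.lm p) by
    simpa using (h 0 hpd).1
  intro q hq
  induction hq with
  | refl => exact ⟨m.lc_ne_zero hp0, fun v => m.le_lm⟩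
  | @tail q r _ hqr ih =>
    obtain ⟨g, hg, hg0, t, ht, rfl⟩ := hqr
    have hle := ih.2 _ (mem_support_iff.2 ht)
    have hne : t + m.lm g ≠ m.lm p := fun h => hno g hg hg0 (h ▸ le_add_self)
    constructor
    · rw [coeff_sub]
      intro h
      refine hne (m.antisymm _ _ hle
        (m.le_of_mem_support_monomial_mul (c := coeff (t + m.lm g) q / m.lc g) (fun h' => ?_)))
      rw [h', sub_zero] at h
      exact ih.1 h
    · intro v hv
      rw [mem_support_iff, coeff_sub] at hv
      by_cases h : coeff v q = 0
      · exact m.trans _ _ _ (m.le_of_mem_support_monomial_mul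
          (fun h' => hv (by rw [h, h', sub_zero]))) hle
      · exact ih.2 v (mem_support_iff.2 h)

section LeadingMonomials

variable {m} [Finite σ] {I : Ideal (MvPolynomial σ K)} {G : Set (MvPolynomial σ K)}

/-- If the leading monomials of `G` divide all leading monomials of `I`, then polynomials
congruent modulo `I` have a common reduct modulo `G`. -/
theorem join_of_sub_mem (hGI : G ⊆ I)
    (hlm : ∀ p ∈ I, p ≠ 0 → ∃ g ∈ G, g ≠ 0 ∧ m.lm g ≤ m.lm p)
    {p q : MvPolynomial σ K} (hpq : p - q ∈ I) : Join (ReflTransGen (m.Red G)) p q := by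
  induction hu : m.lm (p - q) using m.wellFounded_lt.induction generalizing p q with
  | _ u ih =>
  by_cases h0 : p - q = 0
  · rw [sub_eq_zero.1 h0]
    exact ⟨q, .refl, .refl⟩
  obtain ⟨g, hg, hg0, hle⟩ := hlm _ hpq h0
  obtain ⟨t, ht⟩ : ∃ t, t + m.lm g = m.lm (p - q) := ⟨_, tsub_add_cancel_of_le hle⟩
  have hp := m.reflTransGen_sub hg hg0 p t
  have hq := m.reflTransGen_sub hg hg0 q t
  set p' := p - (coeff (t + m.lm g) p / m.lc g) • monomial t (1 : K) * g with hp'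
  set q' := q - (coeff (t + m.lm g) q / m.lc g) • monomial t (1 : K) * g with hq'
  have hsub : p' - q' =
      (p - q) - (coeff (t + m.lm g) (p - q) / m.lc g) • monomial t (1 : K) * g := by
    rw [hp', hq', coeff_sub, sub_div, sub_smul]
    ring
  have hmem : p' - q' ∈ I := by
    rw [hsub]
    exact sub_mem hpq (I.mul_mem_left _ (hGI hg))
  obtain ⟨d, hd, hd'⟩ : Join (ReflTransGen (m.Red G)) p' q' := by
    by_cases h0' : p' - q' = 0
    · rw [sub_eq_zero.1 h0']
      exact ⟨q', .refl, .refl⟩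
    · refine ih _ ?_ hmem rfl
      rw [← hu, ← ht]
      refine m.lt_of_mem_support_sub hg0 (p := p - q) (fun w hw => ht ▸ m.le_lm hw) ?_
      rw [← hsub]
      exact m.lm_mem_support h0'
  exact ⟨d, hp.trans hd, hq.trans hd'⟩

theorem span_eq_of_lm_le (hGI : G ⊆ I)
    (hlm : ∀ p ∈ I, p ≠ 0 → ∃ g ∈ G, g ≠ 0 ∧ m.lm g ≤ m.lm p) : Ideal.span G = I := by
  refine le_antisymm (Ideal.span_le.2 hGI) fun p hp => ?_
  obtain ⟨d, hpd, h0d⟩ := join_of_sub_mem hGI hlm (p := p) (q := 0) (by simpa)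
  simpa using sub_mem (m.sub_mem_span_of_reflTransGen hpd) (m.sub_mem_span_of_reflTransGen h0d)

theorem isGroebner_of_lm_le (hGI : G ⊆ I)
    (hlm : ∀ p ∈ I, p ≠ 0 → ∃ g ∈ G, g ≠ 0 ∧ m.lm g ≤ m.lm p) : m.IsGroebner G := by
  intro a b c hb hc
  refine join_of_sub_mem hGI hlm ?_
  rw [← span_eq_of_lm_le hGI hlm]
  simpa using sub_mem (m.sub_mem_span_of_reflTransGen hc) (m.sub_mem_span_of_reflTransGen hb)

variable (m I) in
/-- Every polynomial is congruent modulo `I` to one without monomials that are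
leading monomials of elements of `I`. -/
theorem exists_normal_form (u : σ →₀ ℕ) (p : MvPolynomial σ K)
    (hp : ∀ v ∈ p.support, m.lt v u) :
    ∃ q, p - q ∈ I ∧ ∀ v ∈ q.support, m.lt v u ∧ ∀ f ∈ I, f ≠ 0 → m.lm f ≠ v := by
  induction u using m.wellFounded_lt.induction generalizing p with
  | _ u ih =>
  by_cases h0 : p = 0
  · exact ⟨0, by simp [h0], by simp⟩
  have hlt := hp _ (m.lm_mem_support h0)
  by_cases hL : ∃ f ∈ I, f ≠ 0 ∧ m.lm f = m.lm p
  · obtain ⟨f, hf, hf0, hfp⟩ := hL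
    obtain ⟨q, hq, hqv⟩ := ih _ hlt
      (p - (coeff (0 + m.lm f) p / m.lc f) • monomial 0 (1 : K) * f) (fun v hv => by
        have := m.lt_of_mem_support_sub hf0 (t := 0)
          (fun w hw => by rw [zero_add, hfp]; exact m.le_lm hw) hv
        rwa [zero_add, hfp] at this)
    refine ⟨q, ?_, fun v hv => ⟨m.lt_trans (hqv v hv).1 hlt, (hqv v hv).2⟩⟩
    convert add_mem hq (I.mul_mem_left
      ((coeff (0 + m.lm f) p / m.lc f) • monomial 0 (1 : K)) hf) using 1
    ring
  · classical
    obtain ⟨q, hq, hqv⟩ := ih _ hlt (p - monomial (m.lm p) (m.lc p)) (fun v hv => by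
      rw [mem_support_iff, coeff_sub, coeff_monomial] at hv
      split_ifs at hv with h
      · subst h
        simp [lc] at hv
      · exact ⟨m.le_lm (by simpa using hv), Ne.symm h⟩)
    refine ⟨q + monomial (m.lm p) (m.lc p), by convert hq using 1; ring, fun v hv => ?_⟩
    by_cases h : v ∈ q.support
    · exact ⟨m.lt_trans (hqv v h).1 hlt, (hqv v h).2⟩
    · rw [mem_support_iff, coeff_add, notMem_support_iff.1 h, coeff_monomial] at hv
      obtain rfl : m.lm p = v := by
        by_contra h'
        simp [h'] at hv
      exact ⟨hlt, fun f hf hf0 hfp => hL ⟨f, hf, hf0, hfp⟩⟩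

end LeadingMonomials

/-- The monic elements of an ideal whose leading monomial is minimal under divisibility among
the leading monomials of the ideal and whose other monomials are not divisible by any of them. -/
def reducedBasis (I : Ideal (MvPolynomial σ K)) : Set (MvPolynomial σ K) :=
  {p | p ∈ I ∧ m.lc p = 1 ∧
    ∀ v ∈ p.support, ∀ f ∈ I, f ≠ 0 → m.lm f ≤ v → m.lm f = m.lm p ∧ v = m.lm p}

section ReducedBasis

variable {m} {I : Ideal (MvPolynomial σ K)}

theorem ne_zero_of_lc_eq_one {p : MvPolynomial σ K} (h : m.lc p = 1) : p ≠ 0 := by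
  rintro rfl
  simp [lc] at h

theorem lm_injOn_reducedBasis : Set.InjOn m.lm (m.reducedBasis I) := by
  rintro p ⟨hp, hp1, hpv⟩ q ⟨hq, hq1, hqv⟩ h
  by_contra hne
  have h0 : p - q ≠ 0 := sub_ne_zero.2 hne
  have hw := m.lm_mem_support h0
  have key : m.lm (p - q) = m.lm p := by
    rw [mem_support_iff, coeff_sub] at hw
    by_cases hwp : coeff (m.lm (p - q)) p = 0
    · have hwq : coeff (m.lm (p - q)) q ≠ 0 := fun hwq => hw (by rw [hwp, hwq, sub_zero])
      rw [h]
      exact (hqv _ (mem_support_iff.2 hwq) _ (sub_mem hp hq) h0 le_rfl).2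
    · exact (hpv _ (mem_support_iff.2 hwp) _ (sub_mem hp hq) h0 le_rfl).2
  rw [mem_support_iff, key, coeff_sub] at hw
  change m.lc p - _ ≠ 0 at hw
  rw [h] at hw
  change m.lc p - m.lc q ≠ 0 at hw
  simp [hp1, hq1] at hw

theorem lm_eq_of_mem_reducedBasis {p f : MvPolynomial σ K} (hp : p ∈ m.reducedBasis I)
    (hf : f ∈ I) (hf0 : f ≠ 0) (h : m.lm f ≤ m.lm p) : m.lm f = m.lm p :=
  (hp.2.2 _ (m.lm_mem_support (ne_zero_of_lc_eq_one hp.2.1)) f hf hf0 h).1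

theorem finite_reducedBasis [Finite σ] : (m.reducedBasis I).Finite := by
  refine Set.Finite.of_finite_image ?_ lm_injOn_reducedBasis
  refine WellQuasiOrderedLE.finite_of_isAntichain ?_
  rintro _ ⟨p, hp, rfl⟩ _ ⟨q, hq, rfl⟩ hne hle
  exact hne (lm_eq_of_mem_reducedBasis hq hp.1 (ne_zero_of_lc_eq_one hp.2.1) hle)

theorem exists_mem_reducedBasis_lm_le [Finite σ] {p : MvPolynomial σ K} (hp : p ∈ I)
    (hp0 : p ≠ 0) : ∃ g ∈ m.reducedBasis I, g ≠ 0 ∧ m.lm g ≤ m.lm p := by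
  obtain ⟨_, ⟨⟨f, hf, hf0, rfl⟩, hfp⟩, hmin⟩ := WellFounded.has_min
    (_root_.wellFounded_lt : WellFounded ((· < ·) : (σ →₀ ℕ) → (σ →₀ ℕ) → Prop))
    {v | (∃ f ∈ I, f ≠ 0 ∧ m.lm f = v) ∧ v ≤ m.lm p} ⟨_, ⟨p, hp, hp0, rfl⟩, le_rfl⟩
  have hmin' : ∀ g ∈ I, g ≠ 0 → m.lm g ≤ m.lm f → m.lm g = m.lm f := fun g hg hg0 hle =>
    hle.eq_of_not_lt (hmin _ ⟨⟨g, hg, hg0, rfl⟩, hle.trans hfp⟩)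
  classical
  obtain ⟨q, hq, hqv⟩ := m.exists_normal_form I (m.lm f)
    (C (m.lc f)⁻¹ * f - monomial (m.lm f) 1) (fun v hv => by
      rw [mem_support_iff, coeff_sub, coeff_C_mul, coeff_monomial] at hv
      split_ifs at hv with h
      · subst h
        exact absurd (by rw [← lc, inv_mul_cancel₀ (m.lc_ne_zero hf0), sub_self]) hv
      · exact ⟨m.le_lm (mem_support_iff.2 (by aesop)), Ne.symm h⟩)
  set g := monomial (m.lm f) 1 + q with hg
  have hcoeff : coeff (m.lm f) g = 1 := by
    have : coeff (m.lm f) q = 0 := by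
      by_contra h
      exact (hqv _ (mem_support_iff.2 h)).1.2 rfl
    simp [hg, this]
  have hsupp : ∀ v ∈ g.support, v ≠ m.lm f → v ∈ q.support := by
    intro v hv hne
    rw [mem_support_iff] at hv ⊢
    simpa [hg, coeff_monomial, hne.symm] using hv
  have hlm : m.lm g = m.lm f := by
    refine m.lm_eq (mem_support_iff.2 (by simp [hcoeff])) fun v hv => ?_
    by_cases h : v = m.lm f
    · exact h ▸ m.refl _
    · exact (hqv v (hsupp v hv h)).1.1
  have hlc : m.lc g = 1 := by rw [lc, hlm, hcoeff]
  have hgI : g ∈ I := by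
    convert sub_mem (I.mul_mem_left (C (m.lc f)⁻¹) hf) hq using 1
    rw [hg]
    ring
  refine ⟨g, ⟨hgI, hlc, fun v hv h hh hh0 hle => ?_⟩, ne_zero_of_lc_eq_one hlc, hlm ▸ hfp⟩
  rw [hlm]
  by_cases hvf : v = m.lm f
  · exact ⟨hmin' h hh hh0 (hvf ▸ hle), hvf⟩
  · -- `v` is the leading monomial of a multiple of `h`
    exfalso
    refine (hqv v (hsupp v hv hvf)).2 (monomial (v - m.lm h) 1 * h) (I.mul_mem_left _ hh) ?_ ?_
    · exact mul_ne_zero (by simp) hh0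
    · have hvh := tsub_add_cancel_of_le hle
      have e : monomial (v - m.lm h) 1 * h = (1 : K) • monomial (v - m.lm h) (1 : K) * h := by
        rw [one_smul]
      rw [e]
      refine m.lm_eq (mem_support_iff.2 ?_) fun w hw => ?_
      · nth_rewrite 1 [← hvh]
        rw [coeff_lead_monomial_mul, one_mul]
        exact m.lc_ne_zero hh0
      · exact hvh ▸ m.le_of_mem_support_monomial_mul (mem_support_iff.1 hw)

theorem isReducedGroebner_reducedBasis [Finite σ] :
    m.IsReducedGroebner (m.reducedBasis I) := by
  refine ⟨finite_reducedBasis, isGroebner_of_lm_le (I := I) (fun p hp => hp.1)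
    fun p => exists_mem_reducedBasis_lm_le, ?_, ?_, fun b hb => hb.2.1⟩
  · rintro b hb ⟨q, f, ⟨hf, hfb⟩, hf0, t, ht, -⟩
    exact hfb (lm_injOn_reducedBasis hf hb
      (hb.2.2 _ (mem_support_iff.2 ht) f hf.1 hf0 le_add_self).1)
  · exact fun h => ne_zero_of_lc_eq_one h.2.1 rfl

theorem span_reducedBasis [Finite σ] : Ideal.span (m.reducedBasis I) = I :=
  span_eq_of_lm_le (fun _ hp => hp.1) fun _ => exists_mem_reducedBasis_lm_le

theorem IsReducedGroebner.eq_reducedBasis {B : Set (MvPolynomial σ K)}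
    (hB : m.IsReducedGroebner B) : B = m.reducedBasis (Ideal.span B) := by
  obtain ⟨-, hGB, hauto, -, hmonic⟩ := hB
  have hsub : B ⊆ m.reducedBasis (Ideal.span B) := by
    refine fun b hb => ⟨Ideal.subset_span hb, hmonic b hb, fun v hv f hf hf0 hle => ?_⟩
    obtain ⟨g, hg, hg0, hgf⟩ := hGB.exists_lm_le hf hf0
    obtain rfl : g = b := by
      by_contra hne
      refine hauto b hb ⟨_, g, ⟨hg, hne⟩, hg0, v - m.lm g, ?_, rfl⟩
      rw [tsub_add_cancel_of_le (hgf.trans hle)]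
      exact mem_support_iff.1 hv
    have hv' : v = m.lm g := m.antisymm _ _ (m.le_lm hv) (m.le_of_le (hgf.trans hle))
    exact ⟨le_antisymm (hv' ▸ hle) hgf, hv'⟩
  refine hsub.antisymm fun p hp => ?_
  obtain ⟨b, hb, hb0, hle⟩ := hGB.exists_lm_le hp.1 (ne_zero_of_lc_eq_one hp.2.1)
  exact lm_injOn_reducedBasis (hsub hb) hp
    (lm_eq_of_mem_reducedBasis hp (Ideal.subset_span hb) hb0 hle) ▸ hb

end ReducedBasis

end AdmissibleOrder

/-- Existence and uniqueness of reduced Gröbner bases: every finite set of polynomials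
generates an ideal possessing a unique reduced Gröbner basis. -/
theorem exists_unique_reduced_groebner {σ K : Type*} [Fintype σ] [Field K]
    (m : AdmissibleOrder σ) (F : Set (MvPolynomial σ K)) (hF : F.Finite) :
    ∃! G : Set (MvPolynomial σ K),
      m.IsReducedGroebner G ∧ Ideal.span G = Ideal.span F := by
  refine ⟨m.reducedBasis (Ideal.span F),
    ⟨AdmissibleOrder.isReducedGroebner_reducedBasis, AdmissibleOrder.span_reducedBasis⟩, ?_⟩
  rintro B ⟨hB, hBF⟩
  rw [← hBF]
  exact hB.eq_reducedBasis
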